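/- Let Φ be an m×N complex matrix with restricted isometry constant δ_{4s}(Φ) ≤ 0.1, let x ∈ ℂ^N be s-sparse, let e ∈ ℂ^m be arbitrary, let u = Φx + e, and let (a^k) be the sequence of approximations produced by CoSaMP with sparsity level s. Then for every k ≥ 0, ‖x − a^k‖₂ ≤ 2^{−k}·‖x‖₂ + 15·‖e‖₂. -/

import Mathlib

open Matrix
open scoped BigOperators Classical

/-- The Euclidean (ℓ₂) norm of a finitely indexed complex vector. -/
noncomputable def l2 {ι : Type*} [Fintype ι] (x : ι → ℂ) : ℝ :=
  Real.sqrt (∑ i, ‖x i‖ ^ 2)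

/-- The ℓ₁ norm of a finitely indexed complex vector. -/
noncomputable def l1 {ι : Type*} [Fintype ι] (x : ι → ℂ) : ℝ := ∑ i, ‖x i‖

/-- The ℓ∞ (supremum) norm of a finitely indexed complex vector. -/
noncomputable def linf {ι : Type*} [Fintype ι] (x : ι → ℂ) : ℝ := ⨆ i, ‖x i‖

/-- The support of a vector, as a finite set of coordinates. -/
noncomputable def suppF {N : ℕ} (x : Fin N → ℂ) : Finset (Fin N) :=
  Finset.univ.filter fun i => x i ≠ 0

/-- A vector is `s`-sparse when it has at most `s` nonzero entries. -/
def Sparse {N : ℕ} (s : ℕ) (x : Fin N → ℂ) : Prop := (suppF x).card ≤ s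

/-- Restriction of a vector to a set `T` of coordinates: equal to `x` on `T`, zero off `T`. -/
noncomputable def restrictTo {N : ℕ} (x : Fin N → ℂ) (T : Finset (Fin N)) : Fin N → ℂ :=
  fun i => if i ∈ T then x i else 0

/-- `y` is a best `s`-sparse approximation of `x`: it agrees with `x` on a set of `s`
coordinates of largest magnitude and vanishes elsewhere. -/
def IsSparseApprox {N : ℕ} (s : ℕ) (x y : Fin N → ℂ) : Prop :=
  ∃ T : Finset (Fin N), T.card = min s N ∧ y = restrictTo x T ∧
    ∀ i ∈ T, ∀ j ∉ T, ‖x j‖ ≤ ‖x i‖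

/-- The `r`-th restricted isometry constant of `Φ`: the least `δ ≥ 0` such that
`(1-δ)‖x‖² ≤ ‖Φx‖² ≤ (1+δ)‖x‖²` for all `r`-sparse `x`. -/
noncomputable def RIC {m N : ℕ} (Φ : Matrix (Fin m) (Fin N) ℂ) (r : ℕ) : ℝ :=
  sInf {δ : ℝ | 0 ≤ δ ∧ ∀ x : Fin N → ℂ, Sparse r x →
    (1 - δ) * l2 x ^ 2 ≤ l2 (Φ.mulVec x) ^ 2 ∧ l2 (Φ.mulVec x) ^ 2 ≤ (1 + δ) * l2 x ^ 2}

/-- The column submatrix of `Φ` with columns indexed by the finite set `T`. -/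
noncomputable def colSub {m N : ℕ} (Φ : Matrix (Fin m) (Fin N) ℂ) (T : Finset (Fin N)) :
    Matrix (Fin m) {i // i ∈ T} ℂ :=
  Matrix.of fun r c => Φ r c.1

/-- The least-squares estimate `Φ_T† u = (Φ_T* Φ_T)⁻¹ Φ_T* u`, viewed as a vector in `ℂ^N`
supported on `T`. -/
noncomputable def pinvApply {m N : ℕ} (Φ : Matrix (Fin m) (Fin N) ℂ) (T : Finset (Fin N))
    (u : Fin m → ℂ) : Fin N → ℂ :=
  fun j =>
    if h : j ∈ T then (((colSub Φ T)ᴴ * colSub Φ T)⁻¹ * (colSub Φ T)ᴴ).mulVec u ⟨j, h⟩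
    else 0

/-- One iteration of CoSaMP with samples `u` and sparsity level `s`, mapping the current
approximation `a` to the next approximation `a'`. -/
def CoSaMPStep {m N : ℕ} (Φ : Matrix (Fin m) (Fin N) ℂ) (u : Fin m → ℂ) (s : ℕ)
    (a a' : Fin N → ℂ) : Prop :=
  ∃ y2s : Fin N → ℂ,
    IsSparseApprox (2 * s) (Φᴴ.mulVec (u - Φ.mulVec a)) y2s ∧
    IsSparseApprox s (pinvApply Φ (suppF y2s ∪ suppF a) u) a'

/-- `a` is a sequence of approximations produced by CoSaMP: `a 0 = 0` and each successive
approximation arises from one CoSaMP iteration. -/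
def CoSaMPSeq {m N : ℕ} (Φ : Matrix (Fin m) (Fin N) ℂ) (u : Fin m → ℂ) (s : ℕ)
    (a : ℕ → Fin N → ℂ) : Prop :=
  a 0 = 0 ∧ ∀ k, CoSaMPStep Φ u s (a k) (a (k + 1))

/-- The spectral norm (ℓ₂ → ℓ₂ operator norm) of a matrix. -/
noncomputable def specNorm {a b : Type*} [Fintype a] [Fintype b] (M : Matrix a b ℂ) : ℝ :=
  sSup ((fun x => l2 (M.mulVec x)) '' {x | l2 x ≤ 1})

/-- The real part of the standard inner product of two complex vectors. -/
noncomputable def reInner {ι : Type*} [Fintype ι] (x y : ι → ℂ) : ℝ := (star x ⬝ᵥ y).re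

section Euclidean

variable {ι : Type*} [Fintype ι]

theorem l2_eq_norm (x : ι → ℂ) : l2 x = ‖WithLp.toLp 2 x‖ := by
  simp [l2, EuclideanSpace.norm_eq]

theorem l2_nonneg (x : ι → ℂ) : 0 ≤ l2 x := Real.sqrt_nonneg _

theorem l2_sq (x : ι → ℂ) : l2 x ^ 2 = ∑ i, ‖x i‖ ^ 2 :=
  Real.sq_sqrt (Finset.sum_nonneg fun _ _ => sq_nonneg _)

theorem l2_add_le (x y : ι → ℂ) : l2 (x + y) ≤ l2 x + l2 y := by
  simpa only [l2_eq_norm, WithLp.toLp_add] using norm_add_le _ _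

theorem l2_sub_le (x y : ι → ℂ) : l2 (x - y) ≤ l2 x + l2 y := by
  simpa only [l2_eq_norm, WithLp.toLp_sub] using norm_sub_le _ _

theorem eq_zero_of_l2_eq_zero {x : ι → ℂ} (h : l2 x = 0) : x = 0 := by
  rw [l2_eq_norm, norm_eq_zero] at h
  simpa using h

theorem l2_mono {κ : Type*} [Fintype κ] {x : ι → ℂ} {y : κ → ℂ}
    (h : l2 x ^ 2 ≤ l2 y ^ 2) : l2 x ≤ l2 y :=
  le_of_sq_le_sq h (l2_nonneg y)

theorem reInner_eq_re_inner (x y : ι → ℂ) :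
    reInner x y = (inner ℂ (WithLp.toLp 2 x) (WithLp.toLp 2 y)).re := by
  rw [EuclideanSpace.inner_eq_star_dotProduct, dotProduct_comm]
  rfl

theorem reInner_self (x : ι → ℂ) : reInner x x = l2 x ^ 2 := by
  rw [reInner_eq_re_inner, l2_eq_norm, inner_self_eq_norm_sq_to_K]
  norm_cast

theorem reInner_le (x y : ι → ℂ) : reInner x y ≤ l2 x * l2 y := by
  rw [reInner_eq_re_inner, l2_eq_norm, l2_eq_norm]
  exact re_inner_le_norm (𝕜 := ℂ) _ _

theorem reInner_add_right (x y z : ι → ℂ) :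
    reInner x (y + z) = reInner x y + reInner x z := by
  simp [reInner, dotProduct_add]

theorem reInner_sub_right (x y z : ι → ℂ) :
    reInner x (y - z) = reInner x y - reInner x z := by
  simp [reInner, dotProduct_sub]

theorem reInner_comm (x y : ι → ℂ) : reInner x y = reInner y x := by
  rw [reInner_eq_re_inner, reInner_eq_re_inner]
  exact inner_re_symm (𝕜 := ℂ) _ _

theorem reInner_smul_right (t : ℝ) (x y : ι → ℂ) :
    reInner x ((t : ℂ) • y) = t * reInner x y := by
  simp [reInner, dotProduct_smul]

theorem reInner_smul_left (t : ℝ) (x y : ι → ℂ) :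
    reInner ((t : ℂ) • x) y = t * reInner x y := by
  rw [reInner_comm, reInner_smul_right, reInner_comm]

theorem l2_add_sq (x y : ι → ℂ) :
    l2 (x + y) ^ 2 = l2 x ^ 2 + 2 * reInner x y + l2 y ^ 2 := by
  simp only [← reInner_self]
  rw [reInner_add_right, reInner_comm _ x, reInner_comm _ y, reInner_add_right,
    reInner_add_right, reInner_comm y x]
  ring

theorem l2_sub_sq (x y : ι → ℂ) :
    l2 (x - y) ^ 2 = l2 x ^ 2 - 2 * reInner x y + l2 y ^ 2 := by
  simp only [← reInner_self]
  rw [reInner_sub_right, reInner_comm _ x, reInner_comm _ y, reInner_sub_right,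
    reInner_sub_right, reInner_comm y x]
  ring

theorem l2_smul_sq (t : ℝ) (x : ι → ℂ) : l2 ((t : ℂ) • x) ^ 2 = t ^ 2 * l2 x ^ 2 := by
  simp only [← reInner_self, reInner_smul_left, reInner_smul_right]
  ring

theorem reInner_mulVec_conjTranspose {κ : Type*} [Fintype κ] (A : Matrix κ ι ℂ)
    (v : ι → ℂ) (w : κ → ℂ) : reInner v (Aᴴ *ᵥ w) = reInner (A *ᵥ v) w := by
  rw [reInner, reInner, Matrix.dotProduct_mulVec, Matrix.star_mulVec]

theorem l2_le_of_sq_le {x : ι → ℂ} {c : ℝ} (hc : 0 ≤ c) (h : l2 x ^ 2 ≤ c * l2 x) :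
    l2 x ≤ c := by
  rcases (l2_nonneg x).eq_or_lt with h0 | h0
  · rw [← h0]; exact hc
  · nlinarith

theorem exists_l2_mulVec_le {κ : Type*} [Fintype κ] (A : Matrix κ ι ℂ) :
    ∃ C : ℝ, 0 ≤ C ∧ ∀ x, l2 (A *ᵥ x) ^ 2 ≤ C * l2 x ^ 2 := by
  refine ⟨∑ k, ∑ i, ‖A k i‖ ^ 2,
    Finset.sum_nonneg fun _ _ => Finset.sum_nonneg fun _ _ => sq_nonneg _, fun x => ?_⟩
  rw [l2_sq, l2_sq, Finset.sum_mul]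
  refine Finset.sum_le_sum fun k _ => ?_
  calc ‖(A *ᵥ x) k‖ ^ 2 ≤ (∑ i, ‖A k i‖ * ‖x i‖) ^ 2 := by
        gcongr
        simp only [← norm_mul]
        exact norm_sum_le Finset.univ fun i => A k i * x i
    _ ≤ _ := Finset.sum_mul_sq_le_sq_mul_sq _ _ _

end Euclidean

section Restriction

variable {N : ℕ}

theorem suppF_subset_iff {x : Fin N → ℂ} {T : Finset (Fin N)} :
    suppF x ⊆ T ↔ ∀ i ∉ T, x i = 0 := by
  simp only [suppF, Finset.subset_iff, Finset.mem_filter, Finset.mem_univ, true_and]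
  exact forall_congr' fun i => not_imp_comm

theorem suppF_restrictTo_subset (x : Fin N → ℂ) (T : Finset (Fin N)) :
    suppF (restrictTo x T) ⊆ T :=
  suppF_subset_iff.2 fun _ hi => if_neg hi

theorem Sparse.of_subset {x : Fin N → ℂ} {T : Finset (Fin N)} {r : ℕ}
    (h : suppF x ⊆ T) (hT : T.card ≤ r) : Sparse r x :=
  (Finset.card_le_card h).trans hT

theorem suppF_add_subset {x y : Fin N → ℂ} {T : Finset (Fin N)}
    (hx : suppF x ⊆ T) (hy : suppF y ⊆ T) : suppF (x + y) ⊆ T := by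
  rw [suppF_subset_iff] at *
  intro i hi
  simp [hx i hi, hy i hi]

theorem suppF_sub_subset {x y : Fin N → ℂ} {T : Finset (Fin N)}
    (hx : suppF x ⊆ T) (hy : suppF y ⊆ T) : suppF (x - y) ⊆ T := by
  rw [suppF_subset_iff] at *
  intro i hi
  simp [hx i hi, hy i hi]

theorem suppF_smul_subset {x : Fin N → ℂ} {T : Finset (Fin N)} (c : ℂ)
    (hx : suppF x ⊆ T) : suppF (c • x) ⊆ T := by
  rw [suppF_subset_iff] at *
  intro i hi
  simp [hx i hi]

theorem l2_restrictTo_sq (x : Fin N → ℂ) (T : Finset (Fin N)) :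
    l2 (restrictTo x T) ^ 2 = ∑ i ∈ T, ‖x i‖ ^ 2 := by
  rw [l2_sq, ← Finset.sum_filter_add_sum_filter_not Finset.univ (· ∈ T)]
  rw [Finset.sum_eq_zero (s := Finset.univ.filter (· ∉ T)), add_zero]
  · rw [Finset.filter_univ_mem]
    exact Finset.sum_congr rfl fun i hi => by simp [restrictTo, hi]
  · intro i hi
    simp [restrictTo, (Finset.mem_filter.1 hi).2]

theorem restrictTo_sub (x y : Fin N → ℂ) (T : Finset (Fin N)) :
    restrictTo (x - y) T = restrictTo x T - restrictTo y T := by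
  ext i
  by_cases hi : i ∈ T <;> simp [restrictTo, hi]

theorem l2_restrictTo_mono (x : Fin N → ℂ) {S T : Finset (Fin N)} (h : S ⊆ T) :
    l2 (restrictTo x S) ≤ l2 (restrictTo x T) := by
  apply l2_mono
  rw [l2_restrictTo_sq, l2_restrictTo_sq]
  exact Finset.sum_le_sum_of_subset_of_nonneg h fun _ _ _ => sq_nonneg _

theorem reInner_restrictTo_self (x : Fin N → ℂ) (T : Finset (Fin N)) :
    reInner (restrictTo x T) x = l2 (restrictTo x T) ^ 2 := by
  rw [← reInner_self, reInner, reInner]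
  congr 1
  refine Finset.sum_congr rfl fun i _ => ?_
  by_cases hi : i ∈ T <;> simp [restrictTo, hi]

theorem reInner_eq_zero_of_disjoint {x y : Fin N → ℂ} {T : Finset (Fin N)}
    (hx : suppF x ⊆ T) (hy : ∀ i ∈ T, y i = 0) : reInner x y = 0 := by
  rw [suppF_subset_iff] at hx
  rw [reInner, dotProduct, Finset.sum_eq_zero, Complex.zero_re]
  intro i _
  by_cases hi : i ∈ T
  · simp [hy i hi]
  · simp [hx i hi]

/-- Replacing a set by one of at least the same size carrying the largest values does not
decrease the sum over the symmetric difference. -/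
theorem sum_sdiff_le_of_largest {ι : Type*} [DecidableEq ι] {f : ι → ℝ} (hf : ∀ i, 0 ≤ f i)
    {S X : Finset ι} (hcard : X.card ≤ S.card) (hS : ∀ i ∈ S, ∀ j ∉ S, f j ≤ f i) :
    ∑ i ∈ X \ S, f i ≤ ∑ i ∈ S \ X, f i := by
  rcases (X \ S).eq_empty_or_nonempty with h | h
  · rw [h, Finset.sum_empty]
    exact Finset.sum_nonneg fun i _ => hf i
  obtain ⟨j, hj, hmax⟩ := Finset.exists_max_image _ f h
  have hc : (X \ S).card ≤ (S \ X).card := Finset.card_sdiff_le_card_sdiff_iff.2 hcard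
  calc ∑ i ∈ X \ S, f i ≤ (X \ S).card • f j := Finset.sum_le_card_nsmul _ _ _ hmax
    _ ≤ (S \ X).card • f j := nsmul_le_nsmul_left (hf j) hc
    _ ≤ ∑ i ∈ S \ X, f i := Finset.card_nsmul_le_sum _ _ _ fun i hi =>
        hS i (Finset.mem_sdiff.1 hi).1 j (Finset.mem_sdiff.1 hj).2

theorem IsSparseApprox.suppF_card_le {s : ℕ} {x y : Fin N → ℂ} (h : IsSparseApprox s x y) :
    (suppF y).card ≤ s := by
  obtain ⟨T, hT, rfl, -⟩ := h
  exact (Finset.card_le_card (suppF_restrictTo_subset x T)).trans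
    (hT.trans_le (min_le_left _ _))

/-- On any set of at most `s` coordinates, the part missed by a best `s`-sparse approximation
has at most the norm of the part which the approximation picks off that set. -/
theorem IsSparseApprox.l2_restrictTo_sdiff_le {s : ℕ} {x y : Fin N → ℂ}
    (h : IsSparseApprox s x y) {R : Finset (Fin N)} (hR : R.card ≤ s) :
    l2 (restrictTo x (R \ suppF y)) ≤ l2 (restrictTo x (suppF y \ R)) := by
  obtain ⟨T, hT, rfl, hmax⟩ := h
  apply l2_mono
  have hcard : R.card ≤ T.card := by
    rw [hT]
    exact le_min hR (by simpa using Finset.card_le_univ R)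
  have hzero : ∀ i ∈ T, i ∉ suppF (restrictTo x T) → x i = 0 := by
    intro i hi hi'
    simpa [suppF, restrictTo, hi] using hi'
  have hsub := suppF_restrictTo_subset x T
  rw [l2_restrictTo_sq, l2_restrictTo_sq]
  calc ∑ i ∈ R \ suppF (restrictTo x T), ‖x i‖ ^ 2 = ∑ i ∈ R \ T, ‖x i‖ ^ 2 := by
        symm
        refine Finset.sum_subset (Finset.sdiff_subset_sdiff le_rfl hsub) fun i hi hi' => ?_
        simp only [Finset.mem_sdiff, not_and, not_not] at hi hi'
        simp [hzero i (hi' hi.1) hi.2]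
    _ ≤ ∑ i ∈ T \ R, ‖x i‖ ^ 2 :=
        sum_sdiff_le_of_largest (fun _ => sq_nonneg _) hcard fun i hi j hj => by
          gcongr; exact hmax i hi j hj
    _ = ∑ i ∈ suppF (restrictTo x T) \ R, ‖x i‖ ^ 2 := by
        symm
        refine Finset.sum_subset (Finset.sdiff_subset_sdiff hsub le_rfl) fun i hi hi' => ?_
        simp only [Finset.mem_sdiff] at hi hi'
        simp [hzero i hi.1 fun h => hi' ⟨h, hi.2⟩]

theorem IsSparseApprox.l2_sub_le {s : ℕ} {x b y : Fin N → ℂ}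
    (h : IsSparseApprox s b y) (hx : Sparse s x) : l2 (x - y) ≤ 2 * l2 (x - b) := by
  have hby : l2 (b - y) ≤ l2 (x - b) := by
    obtain ⟨T, hT, rfl, hmax⟩ := h
    have hcard : (suppF x).card ≤ T.card := by
      rw [hT]
      exact le_min hx (by simpa using Finset.card_le_univ (suppF x))
    have hsd := sum_sdiff_le_of_largest (f := fun i => ‖b i‖ ^ 2) (fun _ => sq_nonneg _)
      hcard fun i hi j hj => by gcongr; exact hmax i hi j hj
    have e1 : b - restrictTo b T = restrictTo b Tᶜ := by
      ext i
      by_cases hi : i ∈ T <;> simp [restrictTo, hi]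
    have e2 : restrictTo (x - b) (suppF x)ᶜ = - restrictTo b (suppF x)ᶜ := by
      ext i
      by_cases hi : x i = 0 <;> simp [restrictTo, suppF, hi]
    have e3 : l2 (restrictTo b (suppF x)ᶜ) ≤ l2 (x - b) := by
      calc l2 (restrictTo b (suppF x)ᶜ) = l2 (restrictTo (x - b) (suppF x)ᶜ) := by
            rw [e2]; simp [l2]
        _ ≤ l2 (restrictTo (x - b) Finset.univ) := l2_restrictTo_mono _ (Finset.subset_univ _)
        _ = l2 (x - b) := by congr 1; ext i; simp [restrictTo]
    refine le_trans ?_ e3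
    rw [e1]
    apply l2_mono
    rw [l2_restrictTo_sq, l2_restrictTo_sq]
    have c1 := Finset.sum_add_sum_compl T fun i => ‖b i‖ ^ 2
    have c2 := Finset.sum_add_sum_compl (suppF x) fun i => ‖b i‖ ^ 2
    have c3 := Finset.sum_inter_add_sum_sdiff T (suppF x) fun i => ‖b i‖ ^ 2
    have c4 := Finset.sum_inter_add_sum_sdiff (suppF x) T fun i => ‖b i‖ ^ 2
    rw [Finset.inter_comm] at c4
    linarith
  calc l2 (x - y) = l2 ((x - b) + (b - y)) := by congr 1; abel
    _ ≤ l2 (x - b) + l2 (b - y) := l2_add_le _ _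
    _ ≤ 2 * l2 (x - b) := by linarith

end Restriction

section RestrictedIsometry

variable {m N : ℕ}

/-- `Φ` distorts squared norms of vectors supported on `r` coordinates by at most the
relative amount `δ`. -/
def RestrictedIsometry (Φ : Matrix (Fin m) (Fin N) ℂ) (r : ℕ) (δ : ℝ) : Prop :=
  ∀ x : Fin N → ℂ, Sparse r x →
    (1 - δ) * l2 x ^ 2 ≤ l2 (Φ *ᵥ x) ^ 2 ∧ l2 (Φ *ᵥ x) ^ 2 ≤ (1 + δ) * l2 x ^ 2

theorem restrictedIsometry_of_RIC_le {Φ : Matrix (Fin m) (Fin N) ℂ} {r : ℕ} {δ : ℝ}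
    (h : RIC Φ r ≤ δ) : RestrictedIsometry Φ r δ := by
  have hne : {δ : ℝ | 0 ≤ δ ∧ RestrictedIsometry Φ r δ}.Nonempty := by
    obtain ⟨C, hC, hbound⟩ := exists_l2_mulVec_le Φ
    refine ⟨C + 1, by positivity, fun x _ => ⟨?_, ?_⟩⟩
    · nlinarith [sq_nonneg (l2 x), sq_nonneg (l2 (Φ *ᵥ x))]
    · nlinarith [hbound x, sq_nonneg (l2 x)]
  intro x hx
  have key : ∀ ε > 0, (1 - (δ + ε)) * l2 x ^ 2 ≤ l2 (Φ *ᵥ x) ^ 2 ∧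
      l2 (Φ *ᵥ x) ^ 2 ≤ (1 + (δ + ε)) * l2 x ^ 2 := by
    intro ε hε
    obtain ⟨η, hη, hlt⟩ := exists_lt_of_csInf_lt hne (lt_of_le_of_lt h (lt_add_of_pos_right δ hε))
    obtain ⟨h1, h2⟩ := hη.2 x hx
    constructor <;> nlinarith [sq_nonneg (l2 x)]
  have hlim : Filter.Tendsto (fun ε : ℝ => (δ + ε)) (nhdsWithin 0 (Set.Ioi 0)) (nhds δ) := by
    have : Filter.Tendsto (fun ε : ℝ => δ + ε) (nhds 0) (nhds (δ + 0)) :=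
      Continuous.tendsto (by fun_prop) 0
    rw [add_zero] at this
    exact this.mono_left nhdsWithin_le_nhds
  constructor
  · refine le_of_tendsto ((hlim.const_sub 1).mul_const (l2 x ^ 2)) ?_
    filter_upwards [self_mem_nhdsWithin] with ε hε using (key ε hε).1
  · refine ge_of_tendsto ((hlim.const_add 1).mul_const (l2 x ^ 2)) ?_
    filter_upwards [self_mem_nhdsWithin] with ε hε using (key ε hε).2

namespace RestrictedIsometry

variable {Φ : Matrix (Fin m) (Fin N) ℂ} {r : ℕ} {δ : ℝ} {T : Finset (Fin N)}

theorem reInner_mulVec_sub_le (h : RestrictedIsometry Φ r δ) (hT : T.card ≤ r)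
    {u v : Fin N → ℂ} (hu : suppF u ⊆ T) (hv : suppF v ⊆ T) :
    reInner (Φ *ᵥ u) (Φ *ᵥ v) - reInner u v ≤ δ * (l2 u * l2 v) := by
  rcases (l2_nonneg u).eq_or_lt with hp | hp
  · obtain rfl := eq_zero_of_l2_eq_zero hp.symm
    simp [reInner, ← hp]
  rcases (l2_nonneg v).eq_or_lt with hq | hq
  · obtain rfl := eq_zero_of_l2_eq_zero hq.symm
    simp [reInner, ← hq]
  have hu' := suppF_smul_subset (l2 v : ℂ) hu
  have hv' := suppF_smul_subset (l2 u : ℂ) hv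
  have h1 := (h _ (Sparse.of_subset (suppF_add_subset hu' hv') hT)).2
  have h2 := (h _ (Sparse.of_subset (suppF_sub_subset hu' hv') hT)).1
  simp only [Matrix.mulVec_add, Matrix.mulVec_sub, Matrix.mulVec_smul, l2_add_sq, l2_sub_sq,
    l2_smul_sq, reInner_smul_left, reInner_smul_right] at h1 h2
  have hpq : 0 < l2 u * l2 v := mul_pos hp hq
  refine le_of_mul_le_mul_left ?_ hpq
  nlinarith

theorem l2_mulVec_le (h : RestrictedIsometry Φ r 0.1) {u : Fin N → ℂ} (hu : Sparse r u) :
    l2 (Φ *ᵥ u) ≤ 1.05 * l2 u := by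
  refine le_of_sq_le_sq ?_ (by have := l2_nonneg u; positivity)
  nlinarith [(h u hu).2, sq_nonneg (l2 u)]

/-- On few coordinates, the proxy `Φ*(Φ r + e)` is close to `r`. -/
theorem l2_restrictTo_proxy_sub_le (h : RestrictedIsometry Φ r 0.1) {A : Finset (Fin N)}
    {z : Fin N → ℂ} (e : Fin m → ℂ) (hA : (A ∪ suppF z).card ≤ r) :
    l2 (restrictTo (Φᴴ *ᵥ (Φ *ᵥ z + e) - z) A) ≤ 0.1 * l2 z + 1.05 * l2 e := by
  set w := Φᴴ *ᵥ (Φ *ᵥ z + e) - z with hw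
  have hsupp : suppF (restrictTo w A) ⊆ A ∪ suppF z :=
    (suppF_restrictTo_subset w A).trans Finset.subset_union_left
  have h1 := h.reInner_mulVec_sub_le hA hsupp Finset.subset_union_right
  have h2 := h.l2_mulVec_le (Sparse.of_subset hsupp hA)
  have h3 := reInner_le (Φ *ᵥ restrictTo w A) e
  have h4 := reInner_restrictTo_self w A
  have hz := l2_nonneg z
  have he := l2_nonneg e
  apply l2_le_of_sq_le (by positivity)
  rw [← h4]
  conv_lhs => rw [hw]
  rw [reInner_sub_right, reInner_mulVec_conjTranspose, reInner_add_right]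
  nlinarith [mul_le_mul_of_nonneg_right h2 he]

end RestrictedIsometry

theorem suppF_pinvApply_subset (Φ : Matrix (Fin m) (Fin N) ℂ) (T : Finset (Fin N))
    (u : Fin m → ℂ) : suppF (pinvApply Φ T u) ⊆ T :=
  suppF_subset_iff.2 fun _ hi => dif_neg hi

theorem mulVec_dite_eq_colSub_mulVec (Φ : Matrix (Fin m) (Fin N) ℂ) (T : Finset (Fin N))
    (z : {i // i ∈ T} → ℂ) :
    (Φ *ᵥ fun j => if h : j ∈ T then z ⟨j, h⟩ else 0) = colSub Φ T *ᵥ z := by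
  ext k
  simp only [Matrix.mulVec, dotProduct, colSub, Matrix.of_apply]
  rw [← Finset.sum_subset (Finset.subset_univ T) fun j _ hj => by simp [hj],
    ← Finset.sum_coe_sort T]
  exact Finset.sum_congr rfl fun j _ => by simp

/-- The normal equations of the least-squares problem on `T`. -/
theorem RestrictedIsometry.normal_equations {Φ : Matrix (Fin m) (Fin N) ℂ} {r : ℕ} {δ : ℝ}
    (h : RestrictedIsometry Φ r δ) (hδ : δ < 1) {T : Finset (Fin N)} (hT : T.card ≤ r)
    (u : Fin m → ℂ) : ∀ j ∈ T, (Φᴴ *ᵥ (Φ *ᵥ pinvApply Φ T u - u)) j = 0 := by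
  set A := colSub Φ T with hA
  have hinj : Function.Injective (Aᴴ * A).mulVec := by
    rw [← Matrix.coe_mulVecLin, injective_iff_map_eq_zero]
    intro z hz
    rw [Matrix.mulVecLin_apply, ← Matrix.mulVec_mulVec] at hz
    have hAz : l2 (A *ᵥ z) ^ 2 = 0 := by
      rw [← reInner_self, ← reInner_mulVec_conjTranspose, hz]
      simp [reInner]
    set w : Fin N → ℂ := fun j => if h : j ∈ T then z ⟨j, h⟩ else 0 with hw
    have hws : suppF w ⊆ T := suppF_subset_iff.2 fun _ hi => dif_neg hi
    have hlow := (h w (Sparse.of_subset hws hT)).1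
    rw [hw, mulVec_dite_eq_colSub_mulVec, ← hw, ← hA, hAz] at hlow
    have hw0 : l2 w = 0 := by
      have : l2 w ^ 2 ≤ 0 := by
        by_contra! hpos
        nlinarith [mul_pos (sub_pos.2 hδ) hpos]
      exact pow_eq_zero_iff (two_ne_zero) |>.1 (le_antisymm this (sq_nonneg _))
    have hw0' := eq_zero_of_l2_eq_zero hw0
    ext i
    simpa [hw] using congrFun hw0' i.1
  have hunit : IsUnit (Aᴴ * A) := Matrix.mulVec_injective_iff_isUnit.1 hinj
  have hsol : Aᴴ *ᵥ (A *ᵥ (((Aᴴ * A)⁻¹ * Aᴴ) *ᵥ u) - u) = 0 := by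
    rw [Matrix.mulVec_sub, Matrix.mulVec_mulVec, Matrix.mulVec_mulVec, ← Matrix.mul_assoc,
      Matrix.mul_nonsing_inv _ ((Matrix.isUnit_iff_isUnit_det _).1 hunit), Matrix.one_mul,
      sub_self]
  intro j hj
  have hb : Φ *ᵥ pinvApply Φ T u = A *ᵥ (((Aᴴ * A)⁻¹ * Aᴴ) *ᵥ u) :=
    mulVec_dite_eq_colSub_mulVec Φ T _
  rw [hb]
  exact congrFun hsol ⟨j, hj⟩

/-- Least-squares estimation error on a set `T` of coordinates. -/
theorem RestrictedIsometry.l2_sub_pinvApply_le {Φ : Matrix (Fin m) (Fin N) ℂ} {r : ℕ}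
    (h : RestrictedIsometry Φ r 0.1) {T : Finset (Fin N)} {x : Fin N → ℂ}
    (hT : (T ∪ suppF x).card ≤ r) (e : Fin m → ℂ) :
    l2 (x - pinvApply Φ T (Φ *ᵥ x + e)) ≤
      (10 / 9) * l2 (restrictTo x Tᶜ) + (7 / 6) * l2 e := by
  set b := pinvApply Φ T (Φ *ᵥ x + e) with hb
  set c := restrictTo x Tᶜ with hc
  set d := b - restrictTo x T with hd
  have hTr : T.card ≤ r := (Finset.card_le_card Finset.subset_union_left).trans hT
  have hdT : suppF d ⊆ T :=
    suppF_sub_subset (suppF_pinvApply_subset Φ T _) (suppF_restrictTo_subset x T)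
  have hdU : suppF d ⊆ T ∪ suppF x := hdT.trans Finset.subset_union_left
  have hcU : suppF c ⊆ T ∪ suppF x := by
    rw [suppF_subset_iff]
    intro i hi
    have : x i = 0 := by simpa [suppF] using fun h' => hi (Finset.mem_union_right _ h')
    simp [hc, restrictTo, this]
  have hx : x = restrictTo x T + c := by
    ext i
    by_cases hi : i ∈ T <;> simp [hc, restrictTo, hi]
  have hres : Φ *ᵥ b - (Φ *ᵥ x + e) = Φ *ᵥ d - Φ *ᵥ c - e := by
    rw [hd, Matrix.mulVec_sub]
    conv_lhs => rw [hx, Matrix.mulVec_add]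
    abel
  have horth := reInner_eq_zero_of_disjoint hdT
    (h.normal_equations (by norm_num) hTr (Φ *ᵥ x + e))
  rw [← hb, hres, reInner_mulVec_conjTranspose, reInner_sub_right, reInner_sub_right,
    reInner_self] at horth
  have hdc : reInner d c = 0 :=
    reInner_eq_zero_of_disjoint hdT fun i hi => by simp [hc, restrictTo, hi]
  have h1 := h.reInner_mulVec_sub_le hT hdU hcU
  have h2 := h.l2_mulVec_le (Sparse.of_subset hdU hT)
  have h3 := reInner_le (Φ *ᵥ d) e
  have h4 := (h d (Sparse.of_subset hdU hT)).1
  have h0c := l2_nonneg c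
  have h0e := l2_nonneg e
  have hdle : l2 d ≤ (1 / 9) * l2 c + (7 / 6) * l2 e := by
    apply l2_le_of_sq_le (by positivity)
    nlinarith [mul_le_mul_of_nonneg_right h2 h0e]
  calc l2 (x - b) = l2 (c - d) := by
        congr 1
        rw [hd]
        conv_lhs => rw [hx]
        abel
    _ ≤ l2 c + l2 d := l2_sub_le _ _
    _ ≤ _ := by linarith

end RestrictedIsometry

/-- One CoSaMP iteration halves the error, up to a multiple of the noise. -/
theorem CoSaMPStep.l2_sub_le {m N : ℕ} {s : ℕ} {Φ : Matrix (Fin m) (Fin N) ℂ}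
    (h : RestrictedIsometry Φ (4 * s) 0.1) {x a a' : Fin N → ℂ} {e : Fin m → ℂ}
    (hx : Sparse s x) (ha : Sparse s a) (hstep : CoSaMPStep Φ (Φ *ᵥ x + e) s a a') :
    l2 (x - a') ≤ (1 / 2) * l2 (x - a) + (15 / 2) * l2 e := by
  obtain ⟨y, hy, ha'⟩ := hstep
  set z := x - a with hz
  have hv : Φ *ᵥ x + e - Φ *ᵥ a = Φ *ᵥ z + e := by
    rw [hz, Matrix.mulVec_sub]
    abel
  rw [hv] at hy
  have hxc : (suppF x).card ≤ s := hx
  have hac : (suppF a).card ≤ s := ha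
  have hyc := hy.suppF_card_le
  have hzc : (suppF z).card ≤ 2 * s := by
    have hsub : suppF z ⊆ suppF x ∪ suppF a :=
      suppF_sub_subset Finset.subset_union_left Finset.subset_union_right
    have := (Finset.card_le_card hsub).trans (Finset.card_union_le _ _)
    omega
  have hyz : (suppF y ∪ suppF z).card ≤ 4 * s := by
    have := Finset.card_union_le (suppF y) (suppF z)
    omega
  have hT : (suppF y ∪ suppF a ∪ suppF x).card ≤ 4 * s := by
    have h1 := Finset.card_union_le (suppF y ∪ suppF a) (suppF x)
    have h2 := Finset.card_union_le (suppF y) (suppF a)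
    omega
  set p := Φᴴ *ᵥ (Φ *ᵥ z + e) with hp
  have hmissed := h.l2_restrictTo_proxy_sub_le (A := suppF z \ suppF y) e
    ((Finset.card_le_card (Finset.union_subset_union Finset.sdiff_subset le_rfl)).trans
      (by rw [Finset.union_self]; omega))
  have hextra := h.l2_restrictTo_proxy_sub_le (A := suppF y \ suppF z) e
    ((Finset.card_le_card (Finset.union_subset_union Finset.sdiff_subset le_rfl)).trans hyz)
  rw [← hp, restrictTo_sub] at hmissed hextra
  have hz0 : restrictTo z (suppF y \ suppF z) = 0 := by
    ext i
    by_cases hi : z i = 0 <;> simp [restrictTo, suppF, hi]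
  rw [hz0, sub_zero] at hextra
  have hident : l2 (restrictTo z (suppF z \ suppF y)) ≤ 0.2 * l2 z + 2.1 * l2 e := by
    have htri := _root_.l2_sub_le (restrictTo p (suppF z \ suppF y))
      (restrictTo p (suppF z \ suppF y) - restrictTo z (suppF z \ suppF y))
    rw [sub_sub_cancel] at htri
    have := hy.l2_restrictTo_sdiff_le hzc
    linarith
  have hmerge : l2 (restrictTo x (suppF y ∪ suppF a)ᶜ) ≤
      l2 (restrictTo z (suppF z \ suppF y)) := by
    apply l2_mono
    rw [l2_sq, l2_sq]
    refine Finset.sum_le_sum fun i _ => ?_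
    by_cases hyi : y i = 0 <;> by_cases hai : a i = 0 <;> by_cases hxi : x i = 0 <;>
      simp [restrictTo, suppF, hz, hyi, hai, hxi]
  have hest := h.l2_sub_pinvApply_le hT e
  have hprune := ha'.l2_sub_le hx
  have := l2_nonneg z
  have := l2_nonneg e
  linarith

/-- **CoSaMP error decay (sparse signals).**  If `Φ` has restricted isometry constant
`δ_{4s} ≤ 0.1`, `x` is `s`-sparse, and `u = Φx + e`, then the CoSaMP approximations
satisfy `‖x − a^k‖₂ ≤ 2^{-k}‖x‖₂ + 15‖e‖₂`. -/
theorem cosamp_error_decay_sparse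
    {m N : ℕ} (s : ℕ) (hs : 0 < s)
    (Φ : Matrix (Fin m) (Fin N) ℂ) (hΦ : RIC Φ (4 * s) ≤ 0.1)
    (x : Fin N → ℂ) (hx : Sparse s x) (e : Fin m → ℂ)
    (u : Fin m → ℂ) (hu : u = Φ.mulVec x + e)
    (a : ℕ → Fin N → ℂ) (ha : CoSaMPSeq Φ u s a) :
    ∀ k : ℕ, l2 (x - a k) ≤ (2 : ℝ) ^ (-(k : ℤ)) * l2 x + 15 * l2 e := by
  have h := restrictedIsometry_of_RIC_le hΦ
  subst hu
  have hsparse : ∀ k, Sparse s (a k) := by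
    rintro (_ | k)
    · simp [ha.1, Sparse, suppF]
    · obtain ⟨y, -, hy⟩ := ha.2 k
      exact hy.suppF_card_le
  intro k
  induction k with
  | zero =>
    have := l2_nonneg e
    simp only [ha.1, sub_zero, Nat.cast_zero, neg_zero, zpow_zero, one_mul]
    linarith
  | succ k ih =>
    have hstep := (ha.2 k).l2_sub_le h hx (hsparse k)
    have hpow : (2 : ℝ) ^ (-((k + 1 : ℕ) : ℤ)) = (1 / 2) * (2 : ℝ) ^ (-(k : ℤ)) := by
      rw [Nat.cast_add_one, neg_add, zpow_add₀ two_ne_zero]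
      norm_num [mul_comm]
    rw [hpow]
    linarith
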